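/- arXiv:0802.0890 — 2 statements merged into one kernel-verified Lean document; each statement's English description precedes it below -/
import Mathlib

section
/- Let 0 < α ≤ 1/2, let f ∈ 𝒜_α, let E' be a finite subset of 𝕋 with f vanishing on E', and let M > 0. Then for every ε > 0 there exist a constant C > 0 and an outer function F ∈ 𝒜_α vanishing on E' such that (1) ‖F·f − f‖_{𝒜_α} ≤ ε, and (2) |F(ξ)| ≤ C · d(ξ, E')^M for all ξ ∈ 𝕋, where d(ξ, E') is the distance from ξ to E'. -/
open Complex MeasureTheory Set Metric Filter
open scoped ENNReal Classical

noncomputable section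

/-- The open unit disc in `ℂ`. -/
def uDisc : Set ℂ := Metric.ball 0 1

/-- The unit circle in `ℂ`. -/
def uCircle : Set ℂ := Metric.sphere (0 : ℂ) 1

/-- `f` is analytic on the open unit disc and continuous on the closed unit disc. -/
def IsDiscReg (f : ℂ → ℂ) : Prop :=
  DifferentiableOn ℂ f uDisc ∧ ContinuousOn f (Metric.closedBall 0 1)

/-- The little-o Lipschitz condition of order `α` on the closed unit disc:
`|f z - f w| = o(|z-w|^α)` as `|z - w| → 0`. -/
def LittleLip (α : ℝ) (f : ℂ → ℂ) : Prop :=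
  ∀ ε > 0, ∃ δ > 0, ∀ z ∈ Metric.closedBall (0 : ℂ) 1, ∀ w ∈ Metric.closedBall (0 : ℂ) 1,
    ‖z - w‖ < δ → ‖f z - f w‖ ≤ ε * ‖z - w‖ ^ α

/-- Membership in `lip_α`. -/
def MemLip (α : ℝ) (f : ℂ → ℂ) : Prop := IsDiscReg f ∧ LittleLip α f

/-- The Dirichlet integral `D(f) = ∫_𝔻 |f'|² dA` with respect to the normalized
area measure `dA = (1/π)·(Lebesgue)`. -/
def dirInt (f : ℂ → ℂ) : ℝ := (1 / Real.pi) * ∫ z in uDisc, ‖deriv f z‖ ^ 2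

/-- Membership in the Dirichlet space `𝒟`. -/
def MemDir (f : ℂ → ℂ) : Prop :=
  DifferentiableOn ℂ f uDisc ∧ IntegrableOn (fun z => ‖deriv f z‖ ^ 2) uDisc

/-- Sup norm over the unit disc. -/
def supNorm (f : ℂ → ℂ) : ℝ := sSup ((fun z => ‖f z‖) '' uDisc)

/-- The `lip_α` norm `‖f‖_α = ‖f‖_∞ + sup_{z∈𝔻} (1-|z|)^{1-α}|f'(z)|`. -/
def lipNorm (α : ℝ) (f : ℂ → ℂ) : ℝ :=
  supNorm f + sSup ((fun z => (1 - ‖z‖) ^ (1 - α) * ‖deriv f z‖) '' uDisc)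

/-- The `𝒜_α` norm `‖f‖_{𝒜_α} = ‖f‖_α + D(f)^{1/2}`. -/
def ANorm (α : ℝ) (f : ℂ → ℂ) : ℝ := lipNorm α f + Real.sqrt (dirInt f)

/-- Membership in `𝒜_α = 𝒟 ∩ lip_α`. -/
def MemA (α : ℝ) (f : ℂ → ℂ) : Prop := MemDir f ∧ MemLip α f

/-- A closed ideal of the Banach algebra `𝒜_α`, encoded as a set of functions `ℂ → ℂ`
(two functions agreeing on the closed disc represent the same element of `𝒜_α`). -/
structure IsClosedIdeal (α : ℝ) (J : Set (ℂ → ℂ)) : Prop where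
  mem_A : ∀ f ∈ J, MemA α f
  zero_mem : (0 : ℂ → ℂ) ∈ J
  add_mem : ∀ f ∈ J, ∀ g ∈ J, f + g ∈ J
  smul_mem : ∀ (c : ℂ), ∀ f ∈ J, c • f ∈ J
  mul_mem : ∀ f ∈ J, ∀ g : ℂ → ℂ, MemA α g → f * g ∈ J
  ext_mem : ∀ f ∈ J, ∀ g : ℂ → ℂ, MemA α g →
    (∀ z ∈ Metric.closedBall (0 : ℂ) 1, g z = f z) → g ∈ J
  closed : ∀ (F : ℕ → ℂ → ℂ) (f : ℂ → ℂ), (∀ n, F n ∈ J) → MemA α f →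
    Tendsto (fun n => ANorm α (F n - f)) atTop (nhds 0) → f ∈ J

/-- The boundary zero set `E_f = {ξ ∈ 𝕋 : f ξ = 0}`. -/
def bZeros (f : ℂ → ℂ) : Set ℂ := {ξ | ξ ∈ uCircle ∧ f ξ = 0}

/-- An inner function: bounded analytic on `𝔻` with radial limits of modulus `1`
at almost every point of `𝕋`. -/
def IsInner (U : ℂ → ℂ) : Prop :=
  DifferentiableOn ℂ U uDisc ∧ (∀ z ∈ uDisc, ‖U z‖ ≤ 1) ∧
    ∀ᵐ θ : ℝ, Tendsto (fun r : ℝ => ‖U ((r : ℂ) * Complex.exp ((θ : ℂ) * Complex.I))‖)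
      (nhdsWithin 1 (Set.Iio 1)) (nhds 1)

/-- The Schwarz/Herglotz kernel `(e^{iθ}+z)/(e^{iθ}-z)`. -/
def circleKernel (z : ℂ) (θ : ℝ) : ℂ :=
  (Complex.exp ((θ : ℂ) * Complex.I) + z) / (Complex.exp ((θ : ℂ) * Complex.I) - z)

/-- `f` is an outer function. -/
def IsOuter (f : ℂ → ℂ) : Prop :=
  IsDiscReg f ∧ (∃ z ∈ uDisc, f z ≠ 0) ∧
    ∀ z ∈ uDisc, f z = Complex.exp ((1 / (2 * (Real.pi : ℂ))) *
      ∫ θ in (0:ℝ)..(2 * Real.pi),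
        circleKernel z θ * (Real.log ‖f (Complex.exp ((θ : ℂ) * Complex.I))‖ : ℂ))

/-- The outer power `f^ρ`, the outer function with boundary modulus `|f|^ρ`. -/
def outerPow (f : ℂ → ℂ) (ρ : ℝ) (z : ℂ) : ℂ :=
  Complex.exp (((ρ : ℂ) / (2 * (Real.pi : ℂ))) *
    ∫ θ in (0:ℝ)..(2 * Real.pi),
      circleKernel z θ * (Real.log ‖f (Complex.exp ((θ : ℂ) * Complex.I))‖ : ℂ))

/-- The set of angles in `[0, 2π)` whose corresponding point of the circle lies in `A`. -/
def angSet (A : Set ℂ) : Set ℝ :=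
  {θ | θ ∈ Set.Ico (0 : ℝ) (2 * Real.pi) ∧ Complex.exp ((θ : ℂ) * Complex.I) ∈ A}

/-- The outer factor `f_Γ` associated with a boundary set `Γ ⊆ 𝕋`. -/
def outerPart (f : ℂ → ℂ) (Γ : Set ℂ) (z : ℂ) : ℂ :=
  Complex.exp ((1 / (2 * (Real.pi : ℂ))) *
    ∫ θ in angSet Γ, circleKernel z θ * (Real.log ‖f (Complex.exp ((θ : ℂ) * Complex.I))‖ : ℂ))

/-- `𝕋 \ E_f`, the set of boundary points where `f` does not vanish. -/
def offZeros (f : ℂ → ℂ) : Set ℂ := {ξ | ξ ∈ uCircle ∧ f ξ ≠ 0}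

/-- `γ` is a component arc (connected component) of `𝕋 \ E_f`. -/
def IsCompArc (f : ℂ → ℂ) (γ : Set ℂ) : Prop :=
  ∃ x ∈ offZeros f, γ = connectedComponentIn (offZeros f) x

/-- `Γ` is a union of component arcs of `𝕋 \ E_f`. -/
def IsArcUnion (f : ℂ → ℂ) (Γ : Set ℂ) : Prop :=
  Γ ⊆ offZeros f ∧ ∀ x ∈ Γ, connectedComponentIn (offZeros f) x ⊆ Γ

/-- The sector `Δ_γ = {z ∈ 𝔻 : z/|z| ∈ γ}`. -/
def discSector (γ : Set ℂ) : Set ℂ := {z | z ∈ uDisc ∧ ((‖z‖ : ℂ))⁻¹ * z ∈ γ}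

/-- Lower integral of `g` over `S` with respect to the normalized area measure
`dA = (1/π)·(Lebesgue)`. -/
def nlint (S : Set ℂ) (g : ℂ → ℝ) : ℝ≥0∞ :=
  ENNReal.ofReal (1 / Real.pi) * ∫⁻ z in S, ENNReal.ofReal (g z)

/-- `d(z) = min(|z-a|, |z-b|)`, distance to the endpoints of the arc `γ = (a,b)`. -/
def dd (a b z : ℂ) : ℝ := min ‖z - a‖ ‖z - b‖

/-- `Λ_γ`: equals `Γ` if `γ ⊄ Γ`, and `𝕋 \ Γ` if `γ ⊆ Γ`. -/
def lamSet (Γ γ : Set ℂ) : Set ℂ := if γ ⊆ Γ then uCircle \ Γ else Γ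

/-- The function `a_γ(z) = (1/2π)∫_{Λ_γ} (−log|f(e^{iθ})|)/|e^{iθ}−z|² dθ`. -/
def aFun (f : ℂ → ℂ) (Γ γ : Set ℂ) (z : ℂ) : ℝ :=
  (1 / (2 * Real.pi)) * ∫ θ in angSet (lamSet Γ γ),
    (-(Real.log ‖f (Complex.exp ((θ : ℂ) * Complex.I))‖)) /
      ‖Complex.exp ((θ : ℂ) * Complex.I) - z‖ ^ 2

/-- `Δ_γ¹ = {z ∈ Δ_γ : d(z) < 2(1−|z|)}`. -/
def sector1 (a b : ℂ) (γ : Set ℂ) : Set ℂ :=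
  {z | z ∈ discSector γ ∧ dd a b z < 2 * (1 - ‖z‖)}

/-- `Δ_γ² = {z ∈ Δ_γ : d(z) ≥ 2(1−|z|)}`. -/
def sector2 (a b : ℂ) (γ : Set ℂ) : Set ℂ :=
  {z | z ∈ discSector γ ∧ 2 * (1 - ‖z‖) ≤ dd a b z}

/-- `Δ_γ²¹ = {z ∈ Δ_γ² : a_γ(z) ≤ 8|log d(z)|/d(z)}`. -/
def sector21 (f : ℂ → ℂ) (Γ γ : Set ℂ) (a b : ℂ) : Set ℂ :=
  {z | z ∈ sector2 a b γ ∧ aFun f Γ γ z ≤ 8 * |Real.log (dd a b z)| / dd a b z}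

/-- `Δ_γ²² = {z ∈ Δ_γ² : 8|log d(z)|/d(z) < a_γ(z) < 8|log d(z)|/(1−|z|)}`. -/
def sector22 (f : ℂ → ℂ) (Γ γ : Set ℂ) (a b : ℂ) : Set ℂ :=
  {z | z ∈ sector2 a b γ ∧ 8 * |Real.log (dd a b z)| / dd a b z < aFun f Γ γ z ∧
    aFun f Γ γ z < 8 * |Real.log (dd a b z)| / (1 - ‖z‖)}

/-- `Δ_γ²³ = {z ∈ Δ_γ² : a_γ(z) ≥ 8|log d(z)|/(1−|z|)}`. -/
def sector23 (f : ℂ → ℂ) (Γ γ : Set ℂ) (a b : ℂ) : Set ℂ :=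
  {z | z ∈ sector2 a b γ ∧ 8 * |Real.log (dd a b z)| / (1 - ‖z‖) ≤ aFun f Γ γ z}

/-- `μ_z = 1 − 8|log d(z)|/a_γ(z)`. -/
def muOf (f : ℂ → ℂ) (Γ γ : Set ℂ) (a b : ℂ) (z : ℂ) : ℝ :=
  1 - 8 * |Real.log (dd a b z)| / aFun f Γ γ z

/-- The tail union `Γ_m = ⋃_{p ≥ m} γ_p`. -/
def tailUnion (γ : ℕ → Set ℂ) (m : ℕ) : Set ℂ := ⋃ p ∈ Set.Ici m, γ p

end

/-- If `L` is holomorphic on the disc, continuous on its closure and `L 0 = 0`, then `L` is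
recovered from its real part on the circle by the Herglotz kernel. -/
theorem circleAverage_herglotz_re {L : ℂ → ℂ} (hL : DiffContOnCl ℂ L (ball 0 1)) (h0 : L 0 = 0)
    {z : ℂ} (hz : z ∈ ball (0 : ℂ) 1) :
    Real.circleAverage (fun ζ => (ζ + z) / (ζ - z) * ((L ζ).re : ℂ)) 0 1 = L z := by
  have hz1 : ‖z‖ < 1 := by simpa using hz
  have hsub : ∀ ζ ∈ sphere (0 : ℂ) 1, ζ - z ≠ 0 := by
    intro ζ hζ h
    have h1 : ζ = z := sub_eq_zero.mp h
    have h2 : ‖ζ‖ = 1 := by simpa using hζ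
    rw [h1] at h2
    linarith
  have hne : ∀ ζ ∈ closedBall (0 : ℂ) 1, 1 - starRingEnd ℂ z * ζ ≠ 0 := by
    intro ζ hζ h
    have h1 : starRingEnd ℂ z * ζ = 1 := (sub_eq_zero.mp h).symm
    have h2 : ‖z‖ * ‖ζ‖ = 1 := by simpa using congrArg norm h1
    have h3 : ‖ζ‖ ≤ 1 := by simpa using hζ
    nlinarith [norm_nonneg ζ, norm_nonneg z]
  have hLc : ContinuousOn L (sphere 0 1) := by
    have := hL.2
    rw [closure_ball _ one_ne_zero] at this
    exact this.mono sphere_subset_closedBall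
  have hG : DiffContOnCl ℂ (fun ζ => (1 - starRingEnd ℂ z * ζ)⁻¹ * L ζ - 2⁻¹ * L ζ)
      (ball 0 |1|) := by
    rw [abs_one]
    have h1 : DiffContOnCl ℂ (fun ζ => (1 - starRingEnd ℂ z * ζ)⁻¹) (ball 0 1) := by
      refine DifferentiableOn.diffContOnCl ?_
      rw [closure_ball _ one_ne_zero]
      exact DifferentiableOn.inv (by fun_prop) hne
    exact (h1.smul hL).sub (hL.const_smul (2⁻¹ : ℂ))
  have hGc : ContinuousOn (fun ζ => (1 - starRingEnd ℂ z * ζ)⁻¹ * L ζ - 2⁻¹ * L ζ)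
      (sphere 0 1) := by
    have := hG.2
    rw [abs_one, closure_ball _ one_ne_zero] at this
    exact this.mono sphere_subset_closedBall
  have hcG := hGc.circleIntegrable zero_le_one
  have hc1 : CircleIntegrable (fun ζ => ((ζ - 0) / (ζ - z)) • L ζ) 0 1 := by
    apply ContinuousOn.circleIntegrable zero_le_one
    exact (ContinuousOn.div (by fun_prop) (by fun_prop) hsub).smul hLc
  have hc2 : CircleIntegrable (fun ζ => (2⁻¹ : ℂ) • L ζ) 0 1 := by
    apply ContinuousOn.circleIntegrable zero_le_one
    exact hLc.const_smul (2⁻¹ : ℂ)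
  have e1 := DiffContOnCl.circleAverage_smul_div (c := 0) (R := 1) (w := z) (f := L)
    (by rwa [abs_one]) (by rwa [abs_one])
  have e2 := DiffContOnCl.circleAverage (c := 0) (R := 1) (f := fun ζ => (2⁻¹ : ℂ) • L ζ)
    (by rw [abs_one]; exact hL.const_smul (2⁻¹ : ℂ))
  have e3 := DiffContOnCl.circleAverage hG
  have e4 := ContinuousLinearMap.circleAverage_comp_comm
    (L := (Complex.conjCLE : ℂ →L[ℝ] ℂ)) hcG
  rw [e3] at e4
  have key : ∀ ζ ∈ sphere (0 : ℂ) |1|, (ζ + z) / (ζ - z) * ((L ζ).re : ℂ) =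
      (((fun ζ => ((ζ - 0) / (ζ - z)) • L ζ) - (fun ζ => (2⁻¹ : ℂ) • L ζ)) +
      ((Complex.conjCLE : ℂ →L[ℝ] ℂ) ∘
        fun ζ => (1 - starRingEnd ℂ z * ζ)⁻¹ * L ζ - 2⁻¹ * L ζ)) ζ := by
    intro ζ hζ
    rw [abs_one] at hζ
    have h1 := hsub ζ hζ
    have hn : ‖ζ‖ = 1 := by simpa using hζ
    have h2 : ζ * starRingEnd ℂ ζ = 1 := by
      rw [Complex.mul_conj, Complex.normSq_eq_norm_sq, hn]; simp
    have hζ0 : ζ ≠ 0 := by rintro rfl; simp at hn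
    have h3 : starRingEnd ℂ ζ = ζ⁻¹ := eq_inv_of_mul_eq_one_right h2
    have h4 : (1 - z * ζ⁻¹) ≠ 0 := by
      intro h
      apply h1
      field_simp at h
      linear_combination h
    simp only [Pi.add_apply, Pi.sub_apply, Function.comp, sub_zero, smul_eq_mul,
      ContinuousLinearEquiv.coe_coe, Complex.conjCLE_apply, map_sub, map_mul, map_inv₀,
      Complex.conj_conj, map_one, h3, map_ofNat, Complex.re_eq_add_conj]
    have h5 : (1 - z * ζ⁻¹)⁻¹ = ζ / (ζ - z) := by
      field_simp
    rw [h5]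
    field_simp
    ring
  rw [Real.circleAverage_congr_sphere key, Real.circleAverage_add (hc1.sub hc2),
    Real.circleAverage_sub hc1 hc2, e1, e2, e4]
  · simp [h0]
  · exact ((Complex.conjCLE : ℂ →L[ℝ] ℂ).continuous.comp_continuousOn hGc).circleIntegrable
      zero_le_one

/-- A multiplicatively stable form of outerness: `log ‖F‖` is integrable on the circle and its
Herglotz integral is a logarithm of `F`. -/
structure HasLogRep (F : ℂ → ℂ) : Prop where
  integrable : CircleIntegrable (fun ζ => Real.log ‖F ζ‖) 0 1
  ae_ne_zero : ∀ᵐ θ : ℝ, F (circleMap 0 1 θ) ≠ 0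
  eq_exp : ∀ z ∈ uDisc, F z =
    exp (Real.circleAverage (fun ζ => (ζ + z) / (ζ - z) * (Real.log ‖F ζ‖ : ℂ)) 0 1)

theorem continuousOn_kernel {z : ℂ} (hz : z ∈ uDisc) :
    ContinuousOn (fun ζ : ℂ => (ζ + z) / (ζ - z)) (sphere 0 |1|) := by
  refine ContinuousOn.div (by fun_prop) (by fun_prop) ?_
  intro ζ hζ h
  have h1 : ‖ζ‖ = 1 := by simpa using hζ
  have h2 : ‖z‖ < 1 := by simpa [uDisc] using hz
  rw [sub_eq_zero.mp h] at h1
  linarith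

theorem circleIntegrable_kernel_mul {g : ℂ → ℝ} (hg : CircleIntegrable g 0 1) {z : ℂ}
    (hz : z ∈ uDisc) : CircleIntegrable (fun ζ => (ζ + z) / (ζ - z) * (g ζ : ℂ)) 0 1 := by
  have h₁ : CircleIntegrable (fun ζ => (g ζ : ℂ)) 0 1 := by
    simp only [CircleIntegrable, intervalIntegrable_iff] at hg ⊢
    exact Complex.ofRealCLM.integrable_comp hg
  exact h₁.continuousOn_smul (continuousOn_kernel hz)

theorem HasLogRep.one : HasLogRep 1 where
  integrable := by simp
  ae_ne_zero := by simp
  eq_exp := by intro z _; simp [Real.circleAverage]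

theorem HasLogRep.mul {F G : ℂ → ℂ} (hF : HasLogRep F) (hG : HasLogRep G) :
    HasLogRep (F * G) := by
  have hlog : ∀ᵐ θ : ℝ, Real.log ‖(F * G) (circleMap 0 1 θ)‖ =
      Real.log ‖F (circleMap 0 1 θ)‖ + Real.log ‖G (circleMap 0 1 θ)‖ := by
    filter_upwards [hF.ae_ne_zero, hG.ae_ne_zero] with θ h1 h2
    rw [Pi.mul_apply, norm_mul, Real.log_mul (norm_ne_zero_iff.mpr h1) (norm_ne_zero_iff.mpr h2)]
  refine ⟨?_, ?_, ?_⟩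
  · refine (hF.integrable.add hG.integrable).congr_ae ?_
    filter_upwards [ae_restrict_of_ae hlog] with θ h
    exact h.symm
  · filter_upwards [hF.ae_ne_zero, hG.ae_ne_zero] with θ h1 h2 using mul_ne_zero h1 h2
  · intro z hz
    rw [Pi.mul_apply, hF.eq_exp z hz, hG.eq_exp z hz, ← Complex.exp_add,
      ← Real.circleAverage_fun_add (circleIntegrable_kernel_mul hF.integrable hz)
        (circleIntegrable_kernel_mul hG.integrable hz)]
    congr 1
    unfold Real.circleAverage
    congr 1
    refine intervalIntegral.integral_congr_ae ?_
    filter_upwards [hlog] with θ h _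
    rw [h]
    push_cast
    ring

theorem HasLogRep.inv {F : ℂ → ℂ} (hF : HasLogRep F) : HasLogRep F⁻¹ where
  integrable := by
    simpa using! hF.integrable.neg
  ae_ne_zero := by
    filter_upwards [hF.ae_ne_zero] with θ h1 using inv_ne_zero h1
  eq_exp := by
    intro z hz
    rw [Pi.inv_apply, hF.eq_exp z hz, ← Complex.exp_neg]
    simp [Real.circleAverage]

theorem HasLogRep.isOuter {F : ℂ → ℂ} (hF : HasLogRep F) (h : IsDiscReg F) : IsOuter F := by
  have h0 : (0 : ℂ) ∈ uDisc := by simp [uDisc]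
  refine ⟨h, ⟨0, h0, ?_⟩, ?_⟩
  · rw [hF.eq_exp 0 h0]
    exact Complex.exp_ne_zero _
  · intro z hz
    rw [hF.eq_exp z hz, Real.circleAverage]
    simp [circleKernel, circleMap]

/-- The Herglotz formula for `1 - a z` when `‖a‖ < 1`. -/
theorem hasLogRep_of_norm_lt_one {a : ℂ} (ha : ‖a‖ < 1) : HasLogRep (fun z => 1 - a * z) := by
  have hslit : ∀ z ∈ closedBall (0 : ℂ) 1, 1 - a * z ∈ slitPlane := by
    intro z hz
    have hz1 : ‖z‖ ≤ 1 := by simpa using hz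
    refine Or.inl ?_
    have h1 : (a * z).re ≤ ‖a‖ * ‖z‖ := (Complex.re_le_norm _).trans (norm_mul _ _).le
    have h2 : ‖a‖ * ‖z‖ < 1 := by nlinarith [norm_nonneg a, norm_nonneg z]
    rw [Complex.sub_re, Complex.one_re]
    linarith
  have hd : DiffContOnCl ℂ (fun z => Complex.log (1 - a * z)) (ball 0 1) := by
    refine DifferentiableOn.diffContOnCl ?_
    rw [closure_ball _ one_ne_zero]
    exact DifferentiableOn.clog (by fun_prop) hslit
  refine ⟨MeromorphicOn.circleIntegrable_log_norm ?_, ?_, ?_⟩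
  · intro z _
    fun_prop
  · refine Eventually.of_forall fun θ => ?_
    exact slitPlane_ne_zero (hslit _ (by simp))
  · intro z hz
    have h := circleAverage_herglotz_re hd (by simp) hz
    simp only [Complex.log_re] at h
    rw [h, Complex.exp_log (slitPlane_ne_zero (hslit z (ball_subset_closedBall hz)))]

theorem norm_one_sub_le {r : ℝ} (hr : r ≤ 1) {w : ℂ} (hr0 : 0 ≤ r) (hw : ‖w‖ ≤ 1) :
    ‖1 - w‖ ≤ 2 * ‖1 - r * w‖ := by
  have h1 : 1 - w = (1 - r * w) - ((1 - r : ℝ) : ℂ) * w := by push_cast; ring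
  have h2 : 1 - r ≤ ‖1 - r * w‖ := by
    have := norm_sub_norm_le (1 : ℂ) (r * w)
    rw [norm_one, norm_mul, Complex.norm_real, Real.norm_of_nonneg hr0] at this
    nlinarith [norm_nonneg w]
  calc ‖1 - w‖ ≤ ‖1 - r * w‖ + ‖((1 - r : ℝ) : ℂ) * w‖ := by
        rw [h1]; exact norm_sub_le _ _
    _ ≤ ‖1 - r * w‖ + (1 - r) := by
        rw [norm_mul, Complex.norm_real, Real.norm_of_nonneg (by linarith)]
        nlinarith [norm_nonneg w]
    _ ≤ _ := by linarith

/-- The Herglotz formula for `1 - a z` when `‖a‖ = 1`. -/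
theorem hasLogRep_of_norm_eq_one {a : ℂ} (ha : ‖a‖ = 1) : HasLogRep (fun z => 1 - a * z) := by
  have ha0 : a ≠ 0 := by rintro rfl; simp at ha
  have hint : CircleIntegrable (fun ζ => Real.log ‖1 - a * ζ‖) 0 1 :=
    MeromorphicOn.circleIntegrable_log_norm (f := fun z => 1 - a * z) (by intro z _; fun_prop)
  have hne : ∀ᵐ θ : ℝ, 1 - a * circleMap 0 1 θ ≠ 0 := by
    have h0 := (countable_singleton a⁻¹).preimage_circleMap 0 one_ne_zero |>.measure_zero volume
    filter_upwards [measure_eq_zero_iff_ae_notMem.mp h0] with θ hθ h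
    apply hθ
    rw [mem_preimage, mem_singleton_iff]
    exact eq_inv_of_mul_eq_one_right (sub_eq_zero.mp h).symm
  refine ⟨hint, hne, ?_⟩
  intro z hz
  have hK := circleIntegrable_kernel_mul hint hz
  obtain ⟨K, hKb⟩ := (isCompact_sphere (0 : ℂ) |1|).exists_bound_of_continuousOn
    (continuousOn_kernel hz)
  have hlim : Tendsto (fun r : ℝ => Real.circleAverage
      (fun ζ => (ζ + z) / (ζ - z) * (Real.log ‖1 - r * a * ζ‖ : ℂ)) 0 1) (nhdsWithin 1 (Iio 1))
      (nhds (Real.circleAverage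
        (fun ζ => (ζ + z) / (ζ - z) * (Real.log ‖1 - a * ζ‖ : ℂ)) 0 1)) := by
    unfold Real.circleAverage
    refine Tendsto.const_smul ?_ _
    refine intervalIntegral.tendsto_integral_filter_of_dominated_convergence
      (fun θ => K * (Real.log 2 + |Real.log ‖1 - a * circleMap 0 1 θ‖|)) ?_ ?_ ?_ ?_
    · filter_upwards [Ioo_mem_nhdsLT (zero_lt_one' ℝ)] with r hr
      have h1 : CircleIntegrable (fun ζ => Real.log ‖1 - r * a * ζ‖) 0 1 :=
        MeromorphicOn.circleIntegrable_log_norm (f := fun z => 1 - r * a * z)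
          (by intro z _; fun_prop)
      exact ((intervalIntegrable_iff.mp (circleIntegrable_kernel_mul h1 hz))).1
    · filter_upwards [Ioo_mem_nhdsLT (zero_lt_one' ℝ)] with r hr
      filter_upwards [hne] with θ hθ _
      have hζ : circleMap 0 1 θ ∈ sphere (0 : ℂ) |1| := circleMap_mem_sphere' _ _ _
      have h1 : 0 < ‖1 - a * circleMap 0 1 θ‖ := norm_pos_iff.mpr hθ
      have hw : ‖a * circleMap 0 1 θ‖ = 1 := by simp [ha]
      have h2 := norm_one_sub_le hr.2.le hr.1.le hw.le
      rw [← mul_assoc] at h2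
      have h3 : ‖1 - r * a * circleMap 0 1 θ‖ ≤ 2 := by
        refine (norm_sub_le _ _).trans ?_
        rw [mul_assoc, norm_mul, hw, norm_one, Complex.norm_real, Real.norm_of_nonneg hr.1.le]
        linarith [hr.2]
      rw [norm_mul, Complex.norm_real, Real.norm_eq_abs]
      refine mul_le_mul (hKb _ hζ) ?_ (abs_nonneg _) ((norm_nonneg _).trans (hKb _ hζ))
      have h4 : 0 < ‖1 - r * a * circleMap 0 1 θ‖ := by linarith
      rw [abs_le]
      constructor
      · have h5 := Real.log_le_log h1 h2
        rw [Real.log_mul two_ne_zero h4.ne'] at h5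
        linarith [neg_abs_le (Real.log ‖1 - a * circleMap 0 1 θ‖)]
      · have h5 := Real.log_le_log h4 h3
        linarith [abs_nonneg (Real.log ‖1 - a * circleMap 0 1 θ‖)]
    · exact ((intervalIntegrable_const).add hint.abs).const_mul _
    · filter_upwards [hne] with θ hθ _
      refine Tendsto.const_mul _ ?_
      have hc : ContinuousAt (fun r : ℝ => (Real.log ‖1 - r * a * circleMap 0 1 θ‖ : ℂ)) 1 := by
        refine Complex.continuous_ofReal.continuousAt.comp (ContinuousAt.log (by fun_prop) ?_)
        simpa using hθ
      have := hc.tendsto.mono_left (nhdsWithin_le_nhds (s := Iio 1))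
      simpa using this
  have hlim2 : Tendsto (fun r : ℝ => 1 - (r : ℂ) * a * z) (nhdsWithin 1 (Iio 1))
      (nhds (1 - a * z)) := by
    have hc : ContinuousAt (fun r : ℝ => 1 - (r : ℂ) * a * z) 1 := by fun_prop
    simpa using hc.tendsto.mono_left (nhdsWithin_le_nhds (s := Iio 1))
  refine tendsto_nhds_unique hlim2 (((Complex.continuous_exp.tendsto _).comp hlim).congr' ?_)
  filter_upwards [Ioo_mem_nhdsLT (zero_lt_one' ℝ)] with r hr
  have : ‖(r : ℂ) * a‖ < 1 := by
    rw [norm_mul, ha, Complex.norm_real, Real.norm_of_nonneg hr.1.le]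
    linarith [hr.2]
  exact ((hasLogRep_of_norm_lt_one this).eq_exp z hz).symm

theorem IsDiscReg.mul {f g : ℂ → ℂ} (hf : IsDiscReg f) (hg : IsDiscReg g) : IsDiscReg (f * g) :=
  ⟨hf.1.mul hg.1, hf.2.mul hg.2⟩

theorem DifferentiableOn.differentiableAt_uDisc {f : ℂ → ℂ} (hf : DifferentiableOn ℂ f uDisc)
    {z : ℂ} (hz : z ∈ uDisc) : DifferentiableAt ℂ f z :=
  hf.differentiableAt (isOpen_ball.mem_nhds hz)

theorem IsDiscReg.exists_bound {f : ℂ → ℂ} (hf : IsDiscReg f) :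
    ∃ B, 0 < B ∧ ∀ z ∈ closedBall (0 : ℂ) 1, ‖f z‖ ≤ B := by
  obtain ⟨B, hB⟩ := (isCompact_closedBall (0 : ℂ) 1).exists_bound_of_continuousOn hf.2
  exact ⟨max B 1, by positivity, fun z hz => (hB z hz).trans (le_max_left _ _)⟩

theorem norm_add_sq_le {E : Type*} [SeminormedAddCommGroup E] (x y : E) :
    ‖x + y‖ ^ 2 ≤ 2 * ‖x‖ ^ 2 + 2 * ‖y‖ ^ 2 := by
  have := norm_add_le x y
  nlinarith [norm_nonneg (x + y), sq_nonneg (‖x‖ - ‖y‖)]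

theorem LittleLip.mul {α : ℝ} {f g : ℂ → ℂ} (hf : MemLip α f) (hg : MemLip α g) :
    LittleLip α (f * g) := by
  obtain ⟨A, hA, hfA⟩ := hf.1.exists_bound
  obtain ⟨B, hB, hgB⟩ := hg.1.exists_bound
  intro ε hε
  obtain ⟨δ₁, hδ₁, h₁⟩ := hf.2 (ε / (2 * B)) (by positivity)
  obtain ⟨δ₂, hδ₂, h₂⟩ := hg.2 (ε / (2 * A)) (by positivity)
  refine ⟨min δ₁ δ₂, lt_min hδ₁ hδ₂, fun z hz w hw hzw => ?_⟩
  have e₁ := h₁ z hz w hw (hzw.trans_le (min_le_left _ _))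
  have e₂ := h₂ z hz w hw (hzw.trans_le (min_le_right _ _))
  have hp : 0 ≤ ‖z - w‖ ^ α := by positivity
  calc ‖(f * g) z - (f * g) w‖ = ‖f z * (g z - g w) + (f z - f w) * g w‖ := by
        simp only [Pi.mul_apply]; ring_nf
    _ ≤ ‖f z‖ * ‖g z - g w‖ + ‖f z - f w‖ * ‖g w‖ := by
        refine (norm_add_le _ _).trans ?_
        rw [norm_mul, norm_mul]
    _ ≤ A * (ε / (2 * A) * ‖z - w‖ ^ α) + (ε / (2 * B) * ‖z - w‖ ^ α) * B := by
        gcongr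
        exacts [hfA z hz, hgB w hw]
    _ = ε * ‖z - w‖ ^ α := by field_simp; ring

theorem MemDir.of_bound {f : ℂ → ℂ} (hf : DifferentiableOn ℂ f uDisc) {φ : ℂ → ℝ}
    (hφ : IntegrableOn φ uDisc) (h : ∀ z ∈ uDisc, ‖deriv f z‖ ^ 2 ≤ φ z) : MemDir f := by
  refine ⟨hf, Integrable.mono' hφ ?_ ?_⟩
  · exact ((measurable_deriv f).norm.pow_const 2).aestronglyMeasurable
  · filter_upwards [ae_restrict_mem measurableSet_ball] with z hz
    rw [Real.norm_of_nonneg (by positivity)]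
    exact h z hz

theorem MemDir.sub {f g : ℂ → ℂ} (hf : MemDir f) (hg : MemDir g) : MemDir (f - g) := by
  refine MemDir.of_bound (hf.1.sub hg.1) ((hf.2.const_mul 2).add (hg.2.const_mul 2)) ?_
  intro z hz
  rw [deriv_sub (hf.1.differentiableAt_uDisc hz) (hg.1.differentiableAt_uDisc hz), sub_eq_add_neg]
  simpa using norm_add_sq_le (deriv f z) (-deriv g z)

theorem MemA.mul {α : ℝ} {f g : ℂ → ℂ} (hf : MemA α f) (hg : MemA α g) : MemA α (f * g) := by
  refine ⟨?_, hf.2.1.mul hg.2.1, LittleLip.mul hf.2 hg.2⟩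
  obtain ⟨A, hA, hfA⟩ := hf.2.1.exists_bound
  obtain ⟨B, hB, hgB⟩ := hg.2.1.exists_bound
  refine MemDir.of_bound (hf.1.1.mul hg.1.1)
    ((hf.1.2.const_mul (2 * B ^ 2)).add (hg.1.2.const_mul (2 * A ^ 2))) ?_
  intro z hz
  have hz' := ball_subset_closedBall hz
  rw [deriv_mul (hf.1.1.differentiableAt_uDisc hz) (hg.1.1.differentiableAt_uDisc hz)]
  refine (norm_add_sq_le _ _).trans ?_
  rw [norm_mul, norm_mul, mul_pow, mul_pow, Pi.add_apply]
  have h1 : ‖f z‖ ^ 2 ≤ A ^ 2 := by gcongr; exact hfA z hz'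
  have h2 : ‖g z‖ ^ 2 ≤ B ^ 2 := by gcongr; exact hgB z hz'
  nlinarith [sq_nonneg ‖deriv f z‖, sq_nonneg ‖deriv g z‖]

/-- `h` has sup norm, Lipschitz seminorm and (unnormalized) Dirichlet integral at most `ε`. -/
structure IsSmall (α ε : ℝ) (h : ℂ → ℂ) : Prop where
  norm_le : ∀ z ∈ uDisc, ‖h z‖ ≤ ε
  deriv_le : ∀ z ∈ uDisc, (1 - ‖z‖) ^ (1 - α) * ‖deriv h z‖ ≤ ε
  integral_le : ∫ z in uDisc, ‖deriv h z‖ ^ 2 ≤ ε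

theorem IsSmall.add {α ε₁ ε₂ : ℝ} {f g : ℂ → ℂ} (hε₁ : 0 ≤ ε₁) (hε₂ : 0 ≤ ε₂)
    (hf : IsSmall α ε₁ f) (hg : IsSmall α ε₂ g)
    (hfD : MemDir f) (hgD : MemDir g) : IsSmall α (2 * ε₁ + 2 * ε₂) (f + g) := by
  refine ⟨fun z hz => ?_, fun z hz => ?_, ?_⟩
  · refine (norm_add_le _ _).trans ?_
    linarith [hf.norm_le z hz, hg.norm_le z hz]
  · rw [deriv_add (hfD.1.differentiableAt_uDisc hz) (hgD.1.differentiableAt_uDisc hz)]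
    have hz1 : ‖z‖ < 1 := by simpa [uDisc] using hz
    have hp : 0 ≤ (1 - ‖z‖) ^ (1 - α) := Real.rpow_nonneg (by linarith) _
    have := mul_le_mul_of_nonneg_left (norm_add_le (deriv f z) (deriv g z)) hp
    linarith [hf.deriv_le z hz, hg.deriv_le z hz]
  · calc ∫ z in uDisc, ‖deriv (f + g) z‖ ^ 2
        ≤ ∫ z in uDisc, (2 * ‖deriv f z‖ ^ 2 + 2 * ‖deriv g z‖ ^ 2) := by
          refine integral_mono_of_nonneg (Eventually.of_forall fun z => by positivity)
            ((hfD.2.const_mul 2).add (hgD.2.const_mul 2)) ?_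
          filter_upwards [ae_restrict_mem measurableSet_ball] with z hz
          rw [deriv_add (hfD.1.differentiableAt_uDisc hz) (hgD.1.differentiableAt_uDisc hz)]
          exact norm_add_sq_le _ _
      _ = 2 * (∫ z in uDisc, ‖deriv f z‖ ^ 2) + 2 * ∫ z in uDisc, ‖deriv g z‖ ^ 2 := by
          rw [integral_add (hfD.2.const_mul 2) (hgD.2.const_mul 2), integral_const_mul,
            integral_const_mul]
      _ ≤ _ := by linarith [hf.integral_le, hg.integral_le]

theorem IsSmall.aNorm_le {α ε : ℝ} {h : ℂ → ℂ} (hh : IsSmall α ε h) :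
    ANorm α h ≤ 2 * ε + Real.sqrt ε := by
  have hne : uDisc.Nonempty := ⟨0, by simp [uDisc]⟩
  have h1 : supNorm h ≤ ε := csSup_le (hne.image _) (by rintro _ ⟨z, hz, rfl⟩; exact hh.norm_le z hz)
  have h2 : sSup ((fun z => (1 - ‖z‖) ^ (1 - α) * ‖deriv h z‖) '' uDisc) ≤ ε :=
    csSup_le (hne.image _) (by rintro _ ⟨z, hz, rfl⟩; exact hh.deriv_le z hz)
  have h3 : dirInt h ≤ ε := by
    have hpi : 1 / Real.pi ≤ 1 := by
      rw [div_le_one Real.pi_pos]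
      linarith [Real.pi_gt_three]
    have h0 : 0 ≤ ∫ z in uDisc, ‖deriv h z‖ ^ 2 := integral_nonneg fun z => by positivity
    unfold dirInt
    calc _ ≤ 1 * ∫ z in uDisc, ‖deriv h z‖ ^ 2 := by gcongr
      _ ≤ ε := by rw [one_mul]; exact hh.integral_le
  have h4 := Real.sqrt_le_sqrt h3
  unfold ANorm lipNorm
  linarith

/-- Cauchy estimate: the derivative of a `lip_α` function is `o((1-|z|)^{α-1})` at the circle. -/
theorem MemLip.deriv_small {α : ℝ} {h : ℂ → ℂ} (hh : MemLip α h) {ε : ℝ} (hε : 0 < ε) :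
    ∃ δ > 0, ∀ z ∈ uDisc, 1 - ‖z‖ < δ → (1 - ‖z‖) ^ (1 - α) * ‖deriv h z‖ ≤ ε := by
  obtain ⟨δ, hδ, hl⟩ := hh.2 ε hε
  refine ⟨δ, hδ, fun z hz hzδ => ?_⟩
  have hz1 : ‖z‖ < 1 := by simpa [uDisc] using hz
  have hR : 0 < 1 - ‖z‖ := by linarith
  have hsub : closedBall z (1 - ‖z‖) ⊆ closedBall 0 1 :=
    closedBall_subset_closedBall' (by simp)
  have hd : DiffContOnCl ℂ (fun w => h w - h z) (ball z (1 - ‖z‖)) := by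
    refine DiffContOnCl.sub_const ⟨hh.1.1.mono ?_, ?_⟩ _
    · exact ball_subset_ball' (by simp)
    · rw [closure_ball _ hR.ne']
      exact hh.1.2.mono hsub
  have key := Complex.norm_deriv_le_of_forall_mem_sphere_norm_le (C := ε * (1 - ‖z‖) ^ α) hR hd
    (by
      intro w hw
      have hwz : ‖w - z‖ = 1 - ‖z‖ := by simpa [dist_eq_norm] using hw
      rw [← hwz]
      exact hl w (hsub (sphere_subset_closedBall hw)) z (ball_subset_closedBall hz) (by rwa [hwz]))
  rw [deriv_sub_const] at key
  calc (1 - ‖z‖) ^ (1 - α) * ‖deriv h z‖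
      ≤ (1 - ‖z‖) ^ (1 - α) * (ε * (1 - ‖z‖) ^ α / (1 - ‖z‖)) := by
        gcongr
    _ = ε := by
        have : (1 - ‖z‖) ^ (1 - α) * (1 - ‖z‖) ^ α = 1 - ‖z‖ := by
          rw [← Real.rpow_add hR]; simp
        field_simp
        linear_combination this

theorem MemLip.deriv_bound {α : ℝ} (hα : α ≤ 1) {h : ℂ → ℂ} (hh : MemLip α h) :
    ∃ B, 0 < B ∧ ∀ z ∈ uDisc, (1 - ‖z‖) ^ (1 - α) * ‖deriv h z‖ ≤ B := by
  obtain ⟨δ, hδ, hs⟩ := hh.deriv_small one_pos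
  obtain ⟨A, hA, hb⟩ := hh.1.exists_bound
  refine ⟨1 + A / δ, by positivity, fun z hz => ?_⟩
  have hz1 : ‖z‖ < 1 := by simpa [uDisc] using hz
  have hR : 0 < 1 - ‖z‖ := by linarith
  rcases lt_or_ge (1 - ‖z‖) δ with h1 | h1
  · have := hs z hz h1
    have : 0 < A / δ := by positivity
    linarith
  · have hsub : closedBall z (1 - ‖z‖) ⊆ closedBall 0 1 :=
      closedBall_subset_closedBall' (by simp)
    have hd : DiffContOnCl ℂ h (ball z (1 - ‖z‖)) := by
      refine ⟨hh.1.1.mono (ball_subset_ball' (by simp)), ?_⟩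
      rw [closure_ball _ hR.ne']
      exact hh.1.2.mono hsub
    have key := Complex.norm_deriv_le_of_forall_mem_sphere_norm_le hR hd
      (fun w hw => hb w (hsub (sphere_subset_closedBall hw)))
    have h2 : (1 - ‖z‖) ^ (1 - α) ≤ 1 :=
      Real.rpow_le_one hR.le (by linarith [norm_nonneg z]) (by linarith)
    calc (1 - ‖z‖) ^ (1 - α) * ‖deriv h z‖ ≤ 1 * (A / (1 - ‖z‖)) := by gcongr
      _ ≤ 1 * (A / δ) := by gcongr
      _ ≤ 1 + A / δ := by linarith

/-- The multiplier `(1 - a z) / (1 - r a z)`, vanishing at `a⁻¹` and close to `1` elsewhere. -/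
noncomputable def bump (a : ℂ) (r : ℝ) (z : ℂ) : ℂ := (1 - a * z) / (1 - r * a * z)

section Bump

variable {a : ℂ} {r : ℝ} {z : ℂ}

theorem one_sub_le_norm (ha : ‖a‖ = 1) (hr : r ∈ Ioo (0 : ℝ) 1) (hz : ‖z‖ ≤ 1) :
    1 - r ≤ ‖1 - r * a * z‖ := by
  have := norm_sub_norm_le (1 : ℂ) (r * a * z)
  rw [norm_one, norm_mul, norm_mul, ha, Complex.norm_real, Real.norm_of_nonneg hr.1.le] at this
  nlinarith [norm_nonneg z, hr.1]

theorem norm_one_sub_mul_le (ha : ‖a‖ = 1) (hr : r ∈ Ioo (0 : ℝ) 1) (hz : ‖z‖ ≤ 1) :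
    ‖1 - a * z‖ ≤ 2 * ‖1 - r * a * z‖ := by
  have := norm_one_sub_le hr.2.le hr.1.le (w := a * z) (by rw [norm_mul, ha, one_mul]; exact hz)
  rwa [← mul_assoc] at this

theorem one_sub_ne_zero (ha : ‖a‖ = 1) (hr : r ∈ Ioo (0 : ℝ) 1) (hz : ‖z‖ ≤ 1) :
    1 - r * a * z ≠ 0 := by
  have := one_sub_le_norm ha hr hz
  rw [← norm_pos_iff]
  linarith [hr.2]

theorem bump_sub_one (ha : ‖a‖ = 1) (hr : r ∈ Ioo (0 : ℝ) 1) (hz : ‖z‖ ≤ 1) :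
    bump a r z - 1 = -((1 - r : ℝ) : ℂ) * (a * z) / (1 - r * a * z) := by
  have := one_sub_ne_zero ha hr hz
  rw [eq_div_iff this, bump, sub_mul, div_mul_cancel₀ _ this]
  push_cast
  ring

theorem norm_bump_sub_one_le (ha : ‖a‖ = 1) (hr : r ∈ Ioo (0 : ℝ) 1) (hz : ‖z‖ ≤ 1) :
    ‖bump a r z - 1‖ ≤ (1 - r) / ‖1 - r * a * z‖ := by
  rw [bump_sub_one ha hr hz, norm_div, norm_mul, norm_neg, Complex.norm_real, norm_mul, ha,
    Real.norm_of_nonneg (by linarith [hr.2])]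
  gcongr
  nlinarith [hr.2]

theorem hasDerivAt_bump (ha : ‖a‖ = 1) (hr : r ∈ Ioo (0 : ℝ) 1) (hz : ‖z‖ ≤ 1) :
    HasDerivAt (bump a r) (-((1 - r : ℝ) : ℂ) * a / (1 - r * a * z) ^ 2) z := by
  have h0 := one_sub_ne_zero ha hr hz
  have h1 : HasDerivAt (fun z => 1 - a * z) (-(a * 1)) z :=
    ((hasDerivAt_id z).const_mul a).const_sub 1
  have h2 : HasDerivAt (fun z => 1 - r * a * z) (-(r * a * 1)) z :=
    ((hasDerivAt_id z).const_mul (r * a)).const_sub 1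
  refine (h1.div h2 h0).congr_deriv ?_
  congr 1
  push_cast
  ring

theorem norm_deriv_bump (ha : ‖a‖ = 1) (hr : r ∈ Ioo (0 : ℝ) 1) (hz : ‖z‖ ≤ 1) :
    ‖deriv (bump a r) z‖ = (1 - r) / ‖1 - r * a * z‖ ^ 2 := by
  rw [(hasDerivAt_bump ha hr hz).deriv, norm_div, norm_mul, norm_neg, Complex.norm_real, ha,
    Real.norm_of_nonneg (by linarith [hr.2]), norm_pow, mul_one]

theorem norm_deriv_bump_le (ha : ‖a‖ = 1) (hr : r ∈ Ioo (0 : ℝ) 1) (hz : ‖z‖ ≤ 1) :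
    ‖deriv (bump a r) z‖ ≤ 1 / (1 - r) := by
  have h1 := one_sub_le_norm ha hr hz
  have h2 : 0 < 1 - r := by linarith [hr.2]
  rw [norm_deriv_bump ha hr hz]
  calc (1 - r) / ‖1 - r * a * z‖ ^ 2 ≤ (1 - r) / (1 - r) ^ 2 := by gcongr
    _ = 1 / (1 - r) := by field_simp

theorem norm_bump_le (ha : ‖a‖ = 1) (hr : r ∈ Ioo (0 : ℝ) 1) (hz : ‖z‖ ≤ 1) :
    ‖bump a r z‖ ≤ 2 := by
  have h1 := one_sub_le_norm ha hr hz
  have h2 : 0 < 1 - r := by linarith [hr.2]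
  rw [bump, norm_div, div_le_iff₀ (by linarith)]
  exact norm_one_sub_mul_le ha hr hz

theorem norm_bump_le_mul (ha : ‖a‖ = 1) (hr : r ∈ Ioo (0 : ℝ) 1) (hz : ‖z‖ ≤ 1) :
    ‖bump a r z‖ ≤ 1 / (1 - r) * ‖1 - a * z‖ := by
  have h1 := one_sub_le_norm ha hr hz
  have h2 : 0 < 1 - r := by linarith [hr.2]
  calc ‖bump a r z‖ = 1 / ‖1 - r * a * z‖ * ‖1 - a * z‖ := by rw [bump, norm_div]; ring
    _ ≤ _ := by gcongr

theorem isDiscReg_bump (ha : ‖a‖ = 1) (hr : r ∈ Ioo (0 : ℝ) 1) : IsDiscReg (bump a r) := by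
  constructor
  · intro z hz
    exact (hasDerivAt_bump ha hr (by simpa [uDisc] using (ball_subset_closedBall hz))
      ).differentiableAt.differentiableWithinAt
  · intro z hz
    exact (hasDerivAt_bump ha hr (by simpa using hz)).continuousAt.continuousWithinAt

theorem memA_bump {α : ℝ} (hα : α < 1) (ha : ‖a‖ = 1) (hr : r ∈ Ioo (0 : ℝ) 1) :
    MemA α (bump a r) := by
  have hr2 : 0 < 1 - r := by linarith [hr.2]
  refine ⟨MemDir.of_bound (isDiscReg_bump ha hr).1 (φ := fun _ => (1 / (1 - r)) ^ 2) ?_ ?_,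
    isDiscReg_bump ha hr, ?_⟩
  · exact integrableOn_const (measure_ball_lt_top).ne
  · intro z hz
    have hz' : ‖z‖ ≤ 1 := by simpa [uDisc] using (ball_subset_closedBall hz)
    gcongr
    exact norm_deriv_bump_le ha hr hz'
  · intro ε hε
    have hlim : Tendsto (fun t : ℝ => 1 / (1 - r) * t ^ (1 - α)) (nhds 0) (nhds 0) := by
      have : ContinuousAt (fun t : ℝ => 1 / (1 - r) * t ^ (1 - α)) 0 :=
        ContinuousAt.const_mul (Real.continuousAt_rpow_const _ _ (Or.inr (by linarith))) _
      simpa [Real.zero_rpow (by linarith : 1 - α ≠ 0)] using this.tendsto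
    obtain ⟨δ, hδ, hb⟩ := Metric.eventually_nhds_iff.mp (hlim.eventually (gt_mem_nhds hε))
    refine ⟨δ, hδ, fun z hz w hw hzw => ?_⟩
    have hL : ‖bump a r z - bump a r w‖ ≤ 1 / (1 - r) * ‖z - w‖ := by
      refine Convex.norm_image_sub_le_of_norm_deriv_le (s := closedBall 0 1) ?_ ?_
        (convex_closedBall 0 1) hw hz
      · intro x hx
        exact (hasDerivAt_bump ha hr (by simpa using hx)).differentiableAt
      · intro x hx
        exact norm_deriv_bump_le ha hr (by simpa using hx)
    rcases eq_or_ne z w with rfl | hne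
    · simp only [sub_self, norm_zero]
      positivity
    have hp : 0 < ‖z - w‖ := norm_pos_iff.mpr (sub_ne_zero.mpr hne)
    have h3 := (hb (y := ‖z - w‖) (by simpa using hzw)).le
    calc _ ≤ 1 / (1 - r) * ‖z - w‖ := hL
      _ = (1 / (1 - r) * ‖z - w‖ ^ (1 - α)) * ‖z - w‖ ^ α := by
          rw [mul_assoc, ← Real.rpow_add hp]; simp
      _ ≤ ε * ‖z - w‖ ^ α := by gcongr

theorem hasLogRep_bump (ha : ‖a‖ = 1) (hr : r ∈ Ioo (0 : ℝ) 1) : HasLogRep (bump a r) := by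
  have h : ‖(r : ℂ) * a‖ < 1 := by
    rw [norm_mul, ha, Complex.norm_real, Real.norm_of_nonneg hr.1.le]
    linarith [hr.2]
  exact (hasLogRep_of_norm_eq_one ha).mul (hasLogRep_of_norm_lt_one h).inv

end Bump

theorem integrableOn_norm_sub_rpow {β : ℝ} (hβ : -2 < β) {e : ℂ} (he : ‖e‖ ≤ 1) :
    IntegrableOn (fun z : ℂ => ‖z - e‖ ^ β) uDisc := by
  have hloc : LocallyIntegrable (fun z : ℂ => ‖z‖ ^ β) := by
    refine locallyIntegrable_of_norm_le_rpow (C := 1) (α := -β) (by simp) ?_ ?_ ?_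
    · rw [Complex.finrank_real_complex]
      push_cast
      linarith
    · refine Eventually.of_forall fun x => ?_
      rw [Real.norm_of_nonneg (by positivity), neg_neg, one_mul]
    · exact (measurable_norm.pow_const β).aestronglyMeasurable
  have h2 := hloc.integrableOn_isCompact (isCompact_closedBall (0 : ℂ) 2)
  have h3 := ((measurePreserving_sub_right volume e).integrableOn_comp_preimage
    (MeasurableEquiv.subRight e).measurableEmbedding).mpr h2
  refine h3.mono_set fun z hz => ?_
  have hz1 : ‖z‖ < 1 := by simpa [uDisc] using hz
  have := norm_sub_le z e
  simp only [mem_preimage, mem_closedBall, dist_zero_right]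
  linarith

theorem MemLip.local_bounds {α : ℝ} (hα0 : 0 < α) {h : ℂ → ℂ} (hh : MemLip α h) {e : ℂ}
    (he : ‖e‖ = 1) (hhe : h e = 0) {ε : ℝ} (hε : 0 < ε) :
    ∃ η > 0, (∀ z ∈ closedBall (0 : ℂ) 1, ‖z - e‖ < η → ‖h z‖ ≤ ε * ‖z - e‖ ^ α ∧ ‖h z‖ ≤ ε) ∧
      ∀ z ∈ uDisc, ‖z - e‖ < η → (1 - ‖z‖) ^ (1 - α) * ‖deriv h z‖ ≤ ε := by
  obtain ⟨δ₁, hδ₁, h₁⟩ := hh.2 ε hε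
  obtain ⟨δ₂, hδ₂, h₂⟩ := hh.deriv_small hε
  refine ⟨min (min δ₁ δ₂) 1, by positivity, fun z hz hze => ?_, fun z hz hze => ?_⟩
  · have h3 := h₁ z hz e (by simp [he]) (hze.trans_le ((min_le_left _ _).trans (min_le_left _ _)))
    rw [hhe, sub_zero] at h3
    refine ⟨h3, h3.trans ?_⟩
    have := Real.rpow_le_one (norm_nonneg (z - e)) (hze.trans_le (min_le_right _ _)).le hα0.le
    nlinarith
  · refine h₂ z hz ?_
    have h3 := norm_sub_norm_le e z
    rw [he, norm_sub_rev] at h3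
    exact h3.trans_lt (hze.trans_le ((min_le_left _ _).trans (min_le_right _ _)))

theorem MemLip.norm_le_mul_rpow {α : ℝ} (hα0 : 0 < α) {h : ℂ → ℂ} (hh : MemLip α h) {e : ℂ}
    (he : ‖e‖ = 1) (hhe : h e = 0) :
    ∃ H, 0 < H ∧ ∀ z ∈ closedBall (0 : ℂ) 1, ‖h z‖ ≤ H * ‖z - e‖ ^ α := by
  obtain ⟨η, hη, h₁, -⟩ := hh.local_bounds hα0 he hhe one_pos
  obtain ⟨B, hB, hb⟩ := hh.1.exists_bound
  refine ⟨1 + B / η ^ α, by positivity, fun z hz => ?_⟩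
  have hp : 0 ≤ ‖z - e‖ ^ α := by positivity
  have hq : 0 < B / η ^ α := by positivity
  rcases lt_or_ge ‖z - e‖ η with h2 | h2
  · have := (h₁ z hz h2).1
    nlinarith
  · have h3 : η ^ α ≤ ‖z - e‖ ^ α := by gcongr
    calc ‖h z‖ ≤ B := hb z hz
      _ = B / η ^ α * η ^ α := by field_simp
      _ ≤ B / η ^ α * ‖z - e‖ ^ α := by gcongr
      _ ≤ (1 + B / η ^ α) * ‖z - e‖ ^ α := by nlinarith

theorem deriv_mul_bump_sub {a : ℂ} {r : ℝ} (ha : ‖a‖ = 1) (hr : r ∈ Ioo (0 : ℝ) 1) {h : ℂ → ℂ}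
    (hh : DifferentiableOn ℂ h uDisc) {z : ℂ} (hz : z ∈ uDisc) :
    deriv (bump a r * h - h) z = deriv (bump a r) z * h z + (bump a r z - 1) * deriv h z := by
  have hz' : ‖z‖ ≤ 1 := by simpa [uDisc] using (ball_subset_closedBall hz)
  have h1 := (hasDerivAt_bump ha hr hz').differentiableAt
  have h2 := hh.differentiableAt_uDisc hz
  rw [deriv_sub (h1.mul h2) h2, deriv_mul h1 h2]
  ring

theorem norm_sub_eq_one_sub_conj_mul {e : ℂ} (he : ‖e‖ = 1) (z : ℂ) :
    ‖1 - starRingEnd ℂ e * z‖ = ‖z - e‖ := by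
  have h2 : starRingEnd ℂ e * e = 1 := by
    rw [mul_comm, Complex.mul_conj, Complex.normSq_eq_norm_sq, he]; simp
  calc ‖1 - starRingEnd ℂ e * z‖ = ‖starRingEnd ℂ e * (e - z)‖ := by rw [mul_sub, h2]
    _ = ‖z - e‖ := by rw [norm_mul, Complex.norm_conj, he, one_mul, norm_sub_rev]

theorem eventually_one_sub_mul_le (C : ℝ) {ε : ℝ} (hε : 0 < ε) :
    ∀ᶠ r : ℝ in nhdsWithin 1 (Iio 1), (1 - r) * C ≤ ε := by
  have hc : ContinuousAt (fun r : ℝ => (1 - r) * C) 1 := by fun_prop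
  have ht := hc.tendsto.mono_left (nhdsWithin_le_nhds (s := Iio 1))
  simp only [sub_self, zero_mul] at ht
  filter_upwards [ht.eventually (gt_mem_nhds hε)] with r hr using hr.le

section Approx

variable {α : ℝ} {h : ℂ → ℂ} {e : ℂ}

theorem eventually_lip_small (hα0 : 0 < α) (hα1 : α ≤ 1) (hh : MemLip α h) (he : ‖e‖ = 1)
    (hhe : h e = 0) {ε : ℝ} (hε : 0 < ε) :
    ∀ᶠ r : ℝ in nhdsWithin 1 (Iio 1), ∀ z ∈ uDisc,
      ‖(bump (starRingEnd ℂ e) r * h - h) z‖ ≤ ε ∧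
      (1 - ‖z‖) ^ (1 - α) * ‖deriv (bump (starRingEnd ℂ e) r * h - h) z‖ ≤ 3 * ε := by
  have ha : ‖starRingEnd ℂ e‖ = 1 := by rw [Complex.norm_conj, he]
  obtain ⟨η, hη, hloc, hloc'⟩ := hh.local_bounds hα0 he hhe hε
  obtain ⟨B, hB, hb⟩ := hh.1.exists_bound
  obtain ⟨B', hB', hb'⟩ := hh.deriv_bound hα1
  filter_upwards [Ioo_mem_nhdsLT (zero_lt_one' ℝ), eventually_one_sub_mul_le (2 / η * B) hε,
    eventually_one_sub_mul_le (2 / η * B') hε, eventually_one_sub_mul_le ((2 / η) ^ 2 * B) hε]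
    with r hr hr₁ hr₂ hr₃ z hz
  have hz1 : ‖z‖ < 1 := by simpa [uDisc] using hz
  have hzc : z ∈ closedBall (0 : ℂ) 1 := ball_subset_closedBall hz
  have hr2 : 0 < 1 - r := by linarith [hr.2]
  have hu := norm_bump_sub_one_le ha hr hz1.le
  have hu' := norm_deriv_bump ha hr hz1.le
  have hρ₁ := one_sub_le_norm ha hr hz1.le
  have hρ₂ := norm_one_sub_mul_le ha hr hz1.le
  rw [norm_sub_eq_one_sub_conj_mul he] at hρ₂
  set ρ := ‖1 - r * starRingEnd ℂ e * z‖
  have hρ : 0 < ρ := by linarith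
  set b := bump (starRingEnd ℂ e) r
  have hu1 : ‖b z - 1‖ ≤ 1 := hu.trans (by rw [div_le_one hρ]; exact hρ₁)
  set t := (1 - ‖z‖) ^ (1 - α)
  have ht0 : 0 ≤ t := Real.rpow_nonneg (by linarith) _
  have ht1 : t ≤ 1 := Real.rpow_le_one (by linarith) (by linarith [norm_nonneg z]) (by linarith)
  have hval : (b * h - h) z = (b z - 1) * h z := by simp only [Pi.sub_apply, Pi.mul_apply]; ring
  have hder : t * ‖deriv (b * h - h) z‖ ≤
      ‖deriv b z‖ * (t * ‖h z‖) + ‖b z - 1‖ * (t * ‖deriv h z‖) := by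
    rw [deriv_mul_bump_sub ha hr hh.1.1 hz]
    calc _ ≤ t * (‖deriv b z * h z‖ + ‖(b z - 1) * deriv h z‖) := by
          gcongr; exact norm_add_le _ _
      _ = _ := by rw [norm_mul, norm_mul]; ring
  rw [hval, norm_mul]
  rcases lt_or_ge ‖z - e‖ η with hn | hn
  · obtain ⟨hl₁, hl₂⟩ := hloc z hzc hn
    have hl₃ := hloc' z hz hn
    constructor
    · calc _ ≤ 1 * ε := by gcongr
        _ = ε := one_mul _
    · have hze : 1 - ‖z‖ ≤ ‖z - e‖ := by
        have h3 := norm_sub_norm_le e z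
        rwa [he, norm_sub_rev] at h3
      have hze0 : 0 < ‖z - e‖ := by linarith
      have h4 : t * ‖h z‖ ≤ ε * (2 * ρ) := by
        calc t * ‖h z‖ ≤ ‖z - e‖ ^ (1 - α) * (ε * ‖z - e‖ ^ α) := by
              gcongr
              exact Real.rpow_le_rpow (by linarith) hze (by linarith)
          _ = ε * ‖z - e‖ := by
              rw [mul_left_comm, ← Real.rpow_add hze0]; simp
          _ ≤ _ := by gcongr
      calc _ ≤ (1 - r) / ρ ^ 2 * (ε * (2 * ρ)) + 1 * ε := by
            refine hder.trans ?_
            rw [hu']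
            gcongr
        _ = 2 * ε * ((1 - r) / ρ) + ε := by field_simp
        _ ≤ 2 * ε * 1 + ε := by
            gcongr
            rwa [div_le_one hρ]
        _ = 3 * ε := by ring
  · have hρη : η / 2 ≤ ρ := by linarith
    have hu2 : ‖b z - 1‖ ≤ (1 - r) * (2 / η) := by
      calc _ ≤ (1 - r) / ρ := hu
        _ ≤ (1 - r) / (η / 2) := by gcongr
        _ = _ := by field_simp
    constructor
    · calc _ ≤ (1 - r) * (2 / η) * B := by gcongr; exact hb z hzc
        _ ≤ ε := by rw [mul_assoc]; exact hr₁
    · have hu3 : ‖deriv b z‖ ≤ (1 - r) * (2 / η) ^ 2 := by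
        rw [hu']
        calc _ ≤ (1 - r) / (η / 2) ^ 2 := by gcongr
          _ = _ := by field_simp
      calc _ ≤ (1 - r) * (2 / η) ^ 2 * (1 * B) + (1 - r) * (2 / η) * B' := by
            refine hder.trans ?_
            gcongr
            exacts [hb z hzc, hb' z hz]
        _ ≤ 3 * ε := by nlinarith

theorem tendsto_norm_bump_deriv {a z : ℂ} (hne : 1 - a * z ≠ 0) (x y : ℂ) :
    Tendsto (fun r : ℝ => ‖-((1 - r : ℝ) : ℂ) * a / (1 - r * a * z) ^ 2 * x +
      -((1 - r : ℝ) : ℂ) * (a * z) / (1 - r * a * z) * y‖ ^ 2) (nhdsWithin 1 (Iio 1)) (nhds 0) := by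
  have hd : ContinuousAt (fun r : ℝ => 1 - (r : ℂ) * a * z) 1 := by fun_prop
  have h1 : 1 - ((1 : ℝ) : ℂ) * a * z ≠ 0 := by simpa using hne
  have hn (c : ℂ) : ContinuousAt (fun r : ℝ => -((1 - r : ℝ) : ℂ) * c) 1 := by fun_prop
  have hc := (((((hn a).div (hd.pow 2) (pow_ne_zero 2 h1)).mul_const x).add
    (((hn (a * z)).div hd h1).mul_const y)).norm).pow 2
  have ht := hc.tendsto.mono_left (nhdsWithin_le_nhds (s := Iio 1))
  simpa using! ht

theorem tendsto_dirichlet (hα0 : 0 < α) (hh : MemA α h) (he : ‖e‖ = 1) (hhe : h e = 0) :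
    Tendsto (fun r : ℝ => ∫ z in uDisc, ‖deriv (bump (starRingEnd ℂ e) r * h - h) z‖ ^ 2)
      (nhdsWithin 1 (Iio 1)) (nhds 0) := by
  have ha : ‖starRingEnd ℂ e‖ = 1 := by rw [Complex.norm_conj, he]
  obtain ⟨H, hH, hHb⟩ := hh.2.norm_le_mul_rpow hα0 he hhe
  have hlim := tendsto_integral_filter_of_dominated_convergence
    (μ := volume.restrict uDisc) (l := nhdsWithin (1 : ℝ) (Iio 1))
    (F := fun (r : ℝ) z => ‖deriv (bump (starRingEnd ℂ e) r * h - h) z‖ ^ 2) (f := fun _ => 0)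
    (fun z => 8 * H ^ 2 * ‖z - e‖ ^ (2 * α - 2) + 2 * ‖deriv h z‖ ^ 2) ?_ ?_ ?_ ?_
  · simpa using hlim
  · exact Eventually.of_forall fun r => ((measurable_deriv _).norm.pow_const 2).aestronglyMeasurable
  · filter_upwards [Ioo_mem_nhdsLT (zero_lt_one' ℝ)] with r hr
    filter_upwards [ae_restrict_mem measurableSet_ball] with z hz
    have hz1 : ‖z‖ < 1 := by simpa [uDisc] using hz
    have hr2 : 0 < 1 - r := by linarith [hr.2]
    rw [Real.norm_of_nonneg (by positivity), deriv_mul_bump_sub ha hr hh.1.1 hz]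
    refine (norm_add_sq_le _ _).trans ?_
    have hu := norm_bump_sub_one_le ha hr hz1.le
    have hu' := norm_deriv_bump ha hr hz1.le
    have hρ₁ := one_sub_le_norm ha hr hz1.le
    have hρ₂ := norm_one_sub_mul_le ha hr hz1.le
    rw [norm_sub_eq_one_sub_conj_mul he] at hρ₂
    set ρ := ‖1 - r * starRingEnd ℂ e * z‖
    have hρ : 0 < ρ := by linarith
    have hze0 : 0 < ‖z - e‖ := by
      have h3 := norm_sub_norm_le e z
      rw [he, norm_sub_rev] at h3
      linarith
    have hu1 : ‖bump (starRingEnd ℂ e) r z - 1‖ ≤ 1 :=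
      hu.trans (by rw [div_le_one hρ]; exact hρ₁)
    have hd : ‖deriv (bump (starRingEnd ℂ e) r) z‖ ≤ 2 / ‖z - e‖ := by
      rw [hu']
      calc (1 - r) / ρ ^ 2 ≤ ρ / ρ ^ 2 := by gcongr
        _ = 1 / ρ := by field_simp
        _ ≤ 2 / ‖z - e‖ := by
          rw [div_le_div_iff₀ hρ hze0]
          linarith
    have h1 : ‖deriv (bump (starRingEnd ℂ e) r) z * h z‖ ^ 2 ≤
        4 * H ^ 2 * ‖z - e‖ ^ (2 * α - 2) := by
      rw [norm_mul]
      calc _ ≤ (2 / ‖z - e‖ * (H * ‖z - e‖ ^ α)) ^ 2 := by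
            gcongr
            exact hHb z (ball_subset_closedBall hz)
        _ = 4 * H ^ 2 * ((‖z - e‖ ^ α) ^ 2 / ‖z - e‖ ^ 2) := by ring
        _ = _ := by
            rw [Real.rpow_sub hze0, mul_comm 2 α, Real.rpow_mul hze0.le, Real.rpow_two,
              Real.rpow_two]
    have h2 : ‖(bump (starRingEnd ℂ e) r z - 1) * deriv h z‖ ^ 2 ≤ ‖deriv h z‖ ^ 2 := by
      rw [norm_mul]
      gcongr
      exact mul_le_of_le_one_left (norm_nonneg _) hu1
    linarith
  · exact ((integrableOn_norm_sub_rpow (by linarith) he.le).const_mul _).add (hh.1.2.const_mul 2)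
  · filter_upwards [ae_restrict_mem measurableSet_ball] with z hz
    have hz1 : ‖z‖ < 1 := by simpa [uDisc] using hz
    have hne : 1 - starRingEnd ℂ e * z ≠ 0 := by
      rw [← norm_pos_iff, norm_sub_eq_one_sub_conj_mul he]
      have h3 := norm_sub_norm_le e z
      rw [he, norm_sub_rev] at h3
      linarith
    have ht := tendsto_norm_bump_deriv hne (h z) (deriv h z)
    refine ht.congr' ?_
    filter_upwards [Ioo_mem_nhdsLT (zero_lt_one' ℝ)] with r hr
    rw [deriv_mul_bump_sub ha hr hh.1.1 hz, (hasDerivAt_bump ha hr hz1.le).deriv,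
      bump_sub_one ha hr hz1.le]

theorem exists_bump_isSmall (hα0 : 0 < α) (hα1 : α ≤ 1) (hh : MemA α h) (he : ‖e‖ = 1)
    (hhe : h e = 0) {ε : ℝ} (hε : 0 < ε) :
    ∃ r ∈ Ioo (0 : ℝ) 1, IsSmall α ε (bump (starRingEnd ℂ e) r * h - h) := by
  have h0 : ∀ᶠ r in nhdsWithin (1 : ℝ) (Iio 1), r ∈ Ioo (0 : ℝ) 1 :=
    Ioo_mem_nhdsLT (zero_lt_one' ℝ)
  have h1 := eventually_lip_small hα0 hα1 hh.2 he hhe (ε := ε / 3) (by positivity)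
  have h2 := (tendsto_dirichlet hα0 hh he hhe).eventually (gt_mem_nhds hε)
  obtain ⟨r, ⟨hr, hr₁⟩, hr₂⟩ :=
    ((h0.and h1).and h2).exists
  refine ⟨r, hr, fun z hz => ?_, fun z hz => ?_, hr₂.le⟩
  · linarith [(hr₁ z hz).1]
  · linarith [(hr₁ z hz).2]

end Approx

theorem memA_one (α : ℝ) : MemA α 1 := by
  refine ⟨MemDir.of_bound (differentiableOn_const 1) (φ := 0) integrableOn_zero ?_,
    ⟨differentiableOn_const 1, continuousOn_const⟩, ?_⟩
  · intro z _
    simp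
  · intro ε hε
    refine ⟨1, one_pos, fun z _ w _ _ => ?_⟩
    simp only [Pi.one_apply, sub_self, norm_zero]
    positivity

/-- Outer multipliers vanishing at the points of a multiset to the prescribed order, whose
action on `f` is arbitrarily close to the identity. -/
theorem exists_outer_multiplier {α : ℝ} (hα0 : 0 < α) (hα1 : α < 1) {f : ℂ → ℂ} (hf : MemA α f)
    (s : Multiset ℂ) (hs : ∀ e ∈ s, ‖e‖ = 1 ∧ f e = 0) : ∀ ε > 0,
    ∃ F : ℂ → ℂ, HasLogRep F ∧ MemA α F ∧ IsSmall α ε (F * f - f) ∧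
      ∃ C, 0 < C ∧ ∀ e ξ : ℂ, ‖ξ‖ = 1 → ‖F ξ‖ ≤ C * ‖ξ - e‖ ^ s.count e := by
  induction s using Multiset.induction_on with
  | empty =>
    intro ε hε
    refine ⟨1, HasLogRep.one, memA_one α, ?_, 1, one_pos, fun e ξ _ => by simp⟩
    rw [one_mul, sub_self]
    refine ⟨fun z _ => ?_, fun z _ => ?_, ?_⟩ <;> simp [hε.le]
  | cons a s ih =>
    intro ε hε
    obtain ⟨F, hFl, hFA, hFs, C, hC, hb⟩ := ih (fun e he => hs e (Multiset.mem_cons_of_mem he))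
      (ε / 4) (by positivity)
    obtain ⟨ha, hfa⟩ := hs a (Multiset.mem_cons_self a s)
    have ha' : ‖starRingEnd ℂ a‖ = 1 := by rw [Complex.norm_conj, ha]
    have hFf := hFA.mul hf
    obtain ⟨r, hr, hsm⟩ := exists_bump_isSmall hα0 hα1.le hFf ha (by simp [hfa])
      (ε := ε / 4) (by positivity)
    have hr2 : 0 < 1 - r := by linarith [hr.2]
    have hbA := memA_bump hα1 ha' hr
    refine ⟨bump (starRingEnd ℂ a) r * F, (hasLogRep_bump ha' hr).mul hFl, hbA.mul hFA, ?_,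
      (1 / (1 - r) + 2) * C, by positivity, ?_⟩
    · have h1 := hsm.add (by positivity) (by positivity) hFs ((hbA.mul hFf).1.sub hFf.1)
        (hFf.1.sub hf.1)
      convert h1 using 1
      · ring
      · ring
    · intro e ξ hξ
      have hinv : 0 < 1 / (1 - r) := by positivity
      rw [Pi.mul_apply, norm_mul]
      by_cases hea : e = a
      · subst hea
        have h1 := norm_bump_le_mul ha' hr hξ.le
        rw [norm_sub_eq_one_sub_conj_mul ha] at h1
        rw [Multiset.count_cons_self, pow_succ]
        calc _ ≤ (1 / (1 - r) * ‖ξ - e‖) * (C * ‖ξ - e‖ ^ s.count e) := by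
              gcongr
              exact hb e ξ hξ
          _ ≤ ((1 / (1 - r) + 2) * ‖ξ - e‖) * (C * ‖ξ - e‖ ^ s.count e) := by
              gcongr
              linarith
          _ = _ := by ring
      · rw [Multiset.count_cons_of_ne hea]
        calc _ ≤ (1 / (1 - r) + 2) * (C * ‖ξ - e‖ ^ s.count e) := by
              gcongr
              · exact (norm_bump_le ha' hr hξ.le).trans (by linarith)
              · exact hb e ξ hξ
          _ = _ := by ring

/-- Korenblum-type lemma: given `f ∈ 𝒜_α` vanishing on a finite
set `E' ⊆ 𝕋` and `M > 0`, for every `ε > 0` there is an outer function `F ∈ 𝒜_α`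
vanishing on `E'` with `‖Ff − f‖_{𝒜_α} ≤ ε` and `|F(ξ)| ≤ C d(ξ,E')^M` on `𝕋`. -/
theorem finite_zeros_outer_approx (α : ℝ) (hα0 : 0 < α) (hα1 : α ≤ 1/2)
    (f : ℂ → ℂ) (hf : MemA α f)
    (E' : Set ℂ) (hE'fin : E'.Finite) (hE'T : E' ⊆ uCircle)
    (hfE' : ∀ ξ ∈ E', f ξ = 0) (M : ℝ) (hM : 0 < M) :
    ∀ ε > 0, ∃ (C : ℝ) (F : ℂ → ℂ), 0 < C ∧ IsOuter F ∧ MemA α F ∧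
      (∀ ξ ∈ E', F ξ = 0) ∧
      ANorm α (F * f - f) ≤ ε ∧
      (∀ ξ ∈ uCircle, ∀ e ∈ E', ‖F ξ‖ ≤ C * ‖ξ - e‖ ^ M) := by
  intro ε hε
  obtain ⟨N, hN⟩ := exists_nat_ge M
  have hN0 : 0 < N := by exact_mod_cast hM.trans_le hN
  set s : Multiset ℂ := N • hE'fin.toFinset.val with hs
  have hmem : ∀ e ∈ s, ‖e‖ = 1 ∧ f e = 0 := by
    intro e he
    have he' : e ∈ E' := by simpa using Multiset.mem_of_mem_nsmul he
    exact ⟨by simpa [uCircle] using hE'T he', hfE' e he'⟩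
  have hcount : ∀ e ∈ E', s.count e = N := by
    intro e he
    rw [hs, Multiset.count_nsmul, Multiset.count_eq_one_of_mem hE'fin.toFinset.nodup (by simpa),
      mul_one]
  have hδ : 0 < min (ε / 4) ((ε / 4) ^ 2) := by positivity
  obtain ⟨F, hFl, hFA, hFs, C, hC, hb⟩ :=
    exists_outer_multiplier hα0 (by linarith) hf s hmem _ hδ
  refine ⟨C * 2 ^ ((N : ℝ) - M), F, by positivity, hFl.isOuter hFA.2.1, hFA, ?_, ?_, ?_⟩
  · intro ξ hξ
    have := hb ξ ξ (by simpa [uCircle] using hE'T hξ)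
    rw [hcount ξ hξ] at this
    simpa [hN0.ne'] using this
  · refine hFs.aNorm_le.trans ?_
    have h1 : Real.sqrt (min (ε / 4) ((ε / 4) ^ 2)) ≤ ε / 4 := by
      rw [Real.sqrt_le_left (by positivity)]
      exact min_le_right _ _
    linarith [min_le_left (ε / 4) ((ε / 4) ^ 2)]
  · intro ξ hξ e he
    have hξ1 : ‖ξ‖ = 1 := by simpa [uCircle] using hξ
    have he1 : ‖e‖ = 1 := by simpa [uCircle] using hE'T he
    have h1 := hb e ξ hξ1
    rw [hcount e he] at h1
    have h2 : ‖ξ - e‖ ≤ 2 := (norm_sub_le _ _).trans (by rw [hξ1, he1]; norm_num)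
    calc ‖F ξ‖ ≤ C * ‖ξ - e‖ ^ N := h1
      _ = C * (‖ξ - e‖ ^ ((N : ℝ) - M) * ‖ξ - e‖ ^ M) := by
          rw [← Real.rpow_add_of_nonneg (norm_nonneg _) (by linarith) hM.le, sub_add_cancel,
            Real.rpow_natCast]
      _ ≤ C * (2 ^ ((N : ℝ) - M) * ‖ξ - e‖ ^ M) := by
          gcongr
      _ = _ := by ring
end

section
/- Let 0 < α ≤ 1/2, let ℐ be a closed ideal of 𝒜_α, let g ∈ ℐ, and let w ∈ 𝔻 be such that g(w) = 0 and w is not a common zero of ℐ (i.e. there exists h ∈ ℐ with h(w) ≠ 0). Then the function z ↦ g(z)·(1 − w̄z)/(w − z) (extended analytically at z = w) belongs to ℐ. -/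
open Complex MeasureTheory Set Metric Filter
open scoped ENNReal Classical

/-- Near `0`, a linear function is dominated by any positive multiple of a power `t ^ α`, `α < 1`. -/
lemma exists_mul_le_mul_rpow {α : ℝ} (hα : α < 1) {ε : ℝ} (hε : 0 < ε) (K : ℝ) :
    ∃ δ > 0, ∀ t : ℝ, 0 ≤ t → t < δ → K * t ≤ ε * t ^ α := by
  have h1 : 0 < 1 - α := by linarith
  have hcont : Tendsto (fun t : ℝ => K * t ^ (1 - α)) (nhds 0) (nhds (K * 0 ^ (1 - α))) :=
    ((Real.continuousAt_rpow_const 0 (1 - α) (Or.inr h1.le)).tendsto).const_mul K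
  rw [Real.zero_rpow h1.ne', mul_zero] at hcont
  obtain ⟨δ, hδ, h⟩ := Metric.eventually_nhds_iff.1 (hcont.eventually (gt_mem_nhds hε))
  refine ⟨δ, hδ, fun t ht htδ => ?_⟩
  rcases ht.eq_or_lt with rfl | ht0
  · simpa using mul_nonneg hε.le (Real.rpow_nonneg le_rfl α)
  have h2 := (h (y := t) (by simpa [Real.dist_eq, abs_of_pos ht0] using htδ)).le
  calc K * t = K * t ^ (1 - α) * t ^ α := by
        rw [mul_assoc, ← Real.rpow_add ht0]; simp
    _ ≤ ε * t ^ α := mul_le_mul_of_nonneg_right h2 (Real.rpow_nonneg ht α)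

/-- Affine functions belong to `𝒜_α` when `α < 1`. -/
lemma memA_affine {α : ℝ} (hα : α < 1) (a b : ℂ) : MemA α (fun z => a + b * z) := by
  have hd : Differentiable ℂ (fun z : ℂ => a + b * z) := by fun_prop
  refine ⟨⟨hd.differentiableOn, ?_⟩, ⟨hd.differentiableOn, hd.continuous.continuousOn⟩, ?_⟩
  · have : deriv (fun z : ℂ => a + b * z) = fun _ => b := by
      ext z
      simp
    rw [this]
    exact integrableOn_const (measure_ball_lt_top).ne
  · intro ε hε
    obtain ⟨δ, hδ, h⟩ := exists_mul_le_mul_rpow hα hε ‖b‖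
    refine ⟨δ, hδ, fun z _ u _ hzu => ?_⟩
    have : a + b * z - (a + b * u) = b * (z - u) := by ring
    rw [this, norm_mul]
    exact h _ (norm_nonneg _) hzu

/-- A function holomorphic on the disc has bounded derivative on a small ball around each point. -/
lemma exists_ball_deriv_bound {F : ℂ → ℂ} {w : ℂ} (hw : w ∈ uDisc)
    (hF : DifferentiableOn ℂ F uDisc) :
    ∃ ρ > 0, Metric.ball w (2 * ρ) ⊆ uDisc ∧
      ∃ K, 0 ≤ K ∧ ∀ z ∈ Metric.ball w (2 * ρ), ‖deriv F z‖ ≤ K := by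
  have hopen : IsOpen uDisc := Metric.isOpen_ball
  obtain ⟨r, hr, hsub⟩ := Metric.nhds_basis_closedBall.mem_iff.1 (hopen.mem_nhds hw)
  obtain ⟨K, hK⟩ := (isCompact_closedBall w r).exists_bound_of_continuousOn
    ((hF.deriv hopen).continuousOn.mono hsub)
  have hball : Metric.ball w (2 * (r / 2)) ⊆ Metric.closedBall w r := by
    rw [mul_div_cancel₀ r two_ne_zero]
    exact Metric.ball_subset_closedBall
  exact ⟨r / 2, by positivity, hball.trans hsub, K,
    (norm_nonneg _).trans (hK w (Metric.mem_closedBall_self hr.le)), fun z hz => hK z (hball hz)⟩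

/-- The algebra `𝒜_α` is stable under difference quotients at points of the disc. -/
lemma MemA.dslope {α : ℝ} (hα : α < 1) {f : ℂ → ℂ} (hf : MemA α f) {w : ℂ} (hw : w ∈ uDisc) :
    MemA α (dslope f w) := by
  obtain ⟨⟨hfd, hfi⟩, ⟨-, hfc⟩, hfl⟩ := hf
  have hopen : IsOpen uDisc := Metric.isOpen_ball
  have hnhds : uDisc ∈ nhds w := hopen.mem_nhds hw
  have hsub : uDisc ⊆ Metric.closedBall (0 : ℂ) 1 := Metric.ball_subset_closedBall
  set F := _root_.dslope f w with hF
  have hFd : DifferentiableOn ℂ F uDisc := (Complex.differentiableOn_dslope hnhds).2 hfd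
  have hFc : ContinuousOn F (Metric.closedBall 0 1) :=
    (continuousOn_dslope (mem_of_superset hnhds hsub)).2 ⟨hfc, hfd.differentiableAt hnhds⟩
  have hfF : ∀ z, f z = f w + (z - w) * F z := fun z => by
    have := sub_smul_dslope f w z
    rw [smul_eq_mul] at this
    rw [hF, this]; ring
  obtain ⟨M, hM⟩ := (isCompact_closedBall (0 : ℂ) 1).exists_bound_of_continuousOn hFc
  obtain ⟨ρ, hρ, hball, K, hK0, hK⟩ := exists_ball_deriv_bound hw hFd
  refine ⟨⟨hFd, ?_⟩, ⟨hFd, hFc⟩, ?_⟩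
  · have hbound : ∀ z ∈ uDisc,
        ‖deriv F z‖ ^ 2 ≤ (2 / ρ ^ 2) * ‖deriv f z‖ ^ 2 + (2 * M ^ 2 / ρ ^ 2 + K ^ 2) := by
      intro z hz
      by_cases hzw : ‖z - w‖ < ρ
      · have hz' : z ∈ Metric.ball w (2 * ρ) := by
          rw [Metric.mem_ball, dist_eq_norm]; linarith
        have h1 : ‖deriv F z‖ ^ 2 ≤ K ^ 2 := pow_le_pow_left₀ (norm_nonneg _) (hK z hz') 2
        have h2 : 0 ≤ (2 / ρ ^ 2) * ‖deriv f z‖ ^ 2 := by positivity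
        have h3 : 0 ≤ 2 * M ^ 2 / ρ ^ 2 := by positivity
        linarith
      · push Not at hzw
        have hderiv : deriv f z = F z + (z - w) * deriv F z := by
          have h1 := (((hasDerivAt_id z).sub_const w).mul
            (hFd.differentiableAt (hopen.mem_nhds hz)).hasDerivAt).const_add (f w)
          have h2 : f = fun y => f w + (id y - w) * F y := funext hfF
          rw [h2]
          simpa using h1.deriv
        have h1 : ‖z - w‖ * ‖deriv F z‖ ≤ ‖deriv f z‖ + M := by
          rw [← norm_mul, show (z - w) * deriv F z = deriv f z - F z by rw [hderiv]; ring]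
          exact (norm_sub_le _ _).trans (by gcongr; exact hM z (hsub hz))
        have h2 : ρ * ‖deriv F z‖ ≤ ‖deriv f z‖ + M :=
          (mul_le_mul_of_nonneg_right hzw (norm_nonneg _)).trans h1
        have h3 : (ρ * ‖deriv F z‖) ^ 2 ≤ 2 * ‖deriv f z‖ ^ 2 + 2 * M ^ 2 := by
          have := pow_le_pow_left₀ (by positivity) h2 2
          nlinarith [sq_nonneg (‖deriv f z‖ - M)]
        have h4 : ‖deriv F z‖ ^ 2 ≤ (2 * ‖deriv f z‖ ^ 2 + 2 * M ^ 2) / ρ ^ 2 := by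
          rw [le_div_iff₀ (by positivity)]
          linarith [mul_pow ρ ‖deriv F z‖ 2]
        calc ‖deriv F z‖ ^ 2 ≤ (2 * ‖deriv f z‖ ^ 2 + 2 * M ^ 2) / ρ ^ 2 := h4
          _ = (2 / ρ ^ 2) * ‖deriv f z‖ ^ 2 + 2 * M ^ 2 / ρ ^ 2 := by ring
          _ ≤ _ := by nlinarith [sq_nonneg K]
    have hint : IntegrableOn (fun z => (2 / ρ ^ 2) * ‖deriv f z‖ ^ 2 +
        (2 * M ^ 2 / ρ ^ 2 + K ^ 2)) uDisc :=
      (Integrable.const_mul hfi _).add (integrableOn_const (measure_ball_lt_top).ne)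
    refine Integrable.mono' hint
      ((measurable_deriv F).norm.pow_const 2).aestronglyMeasurable ?_
    filter_upwards [ae_restrict_mem hopen.measurableSet] with z hz
    rw [Real.norm_of_nonneg (by positivity)]
    exact hbound z hz
  · intro ε hε
    obtain ⟨δ₁, hδ₁, h₁⟩ := exists_mul_le_mul_rpow hα hε K
    obtain ⟨δ₂, hδ₂, h₂⟩ := exists_mul_le_mul_rpow hα (show 0 < ρ * ε / 2 by positivity) M
    obtain ⟨δ₃, hδ₃, h₃⟩ := hfl (ρ * ε / 2) (by positivity)
    refine ⟨min (min δ₁ δ₂) (min δ₃ ρ), by positivity, fun z hz u hu hzu => ?_⟩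
    simp only [lt_min_iff] at hzu
    obtain ⟨⟨hzu₁, hzu₂⟩, hzu₃, hzuρ⟩ := hzu
    by_cases hzw : ‖z - w‖ < ρ
    · have hz' : z ∈ Metric.ball w (2 * ρ) := by
        rw [Metric.mem_ball, dist_eq_norm]; linarith
      have hu' : u ∈ Metric.ball w (2 * ρ) := by
        rw [Metric.mem_ball, dist_eq_norm]
        have := norm_sub_le_norm_sub_add_norm_sub u z w
        rw [norm_sub_rev u z] at this
        linarith
      exact ((convex_ball w (2 * ρ)).norm_image_sub_le_of_norm_deriv_le
        (fun x hx => hFd.differentiableAt (hopen.mem_nhds (hball hx))) hK hu' hz').trans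
        (h₁ _ (norm_nonneg _) hzu₁)
    · push Not at hzw
      have hid : (z - w) * (F z - F u) = (f z - f u) - F u * (z - u) := by
        rw [hfF z, hfF u]; ring
      have hle : ρ * ‖F z - F u‖ ≤ ρ * (ε * ‖z - u‖ ^ α) := by
        calc ρ * ‖F z - F u‖ ≤ ‖z - w‖ * ‖F z - F u‖ := by gcongr
          _ = ‖(f z - f u) - F u * (z - u)‖ := by rw [← norm_mul, hid]
          _ ≤ ‖f z - f u‖ + ‖F u‖ * ‖z - u‖ := by
            rw [← norm_mul]; exact norm_sub_le _ _
          _ ≤ ρ * ε / 2 * ‖z - u‖ ^ α + ρ * ε / 2 * ‖z - u‖ ^ α :=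
            add_le_add (h₃ z hz u hu hzu₃)
              ((mul_le_mul_of_nonneg_right (hM u hu) (norm_nonneg _)).trans
                (h₂ _ (norm_nonneg _) hzu₂))
          _ = ρ * (ε * ‖z - u‖ ^ α) := by ring
      exact le_of_mul_le_mul_left hle hρ

/-- If `g ∈ ℐ` vanishes at `w ∈ 𝔻` and `w` is not a common zero of
`ℐ`, then `z ↦ g(z)(1 − w̄z)/(w − z)` (extended analytically at `w`) belongs to `ℐ`. -/
theorem div_blaschke_factor_mem (α : ℝ) (hα0 : 0 < α) (hα1 : α ≤ 1/2)
    (J : Set (ℂ → ℂ)) (hJ : IsClosedIdeal α J)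
    (g : ℂ → ℂ) (hg : g ∈ J) (w : ℂ) (hw : w ∈ uDisc) (hgw : g w = 0)
    (hcommon : ∃ h ∈ J, h w ≠ 0) :
    (fun z => if z = w then -(1 - (starRingEnd ℂ) w * w) * deriv g w
      else g z * (1 - (starRingEnd ℂ) w * z) / (w - z)) ∈ J := by
  have hα : α < 1 := by linarith
  obtain ⟨h, hhJ, hhw⟩ := hcommon
  have hG := (hJ.mem_A g hg).dslope hα hw
  have hH := (hJ.mem_A h hhJ).dslope hα hw
  have hdiff : h * dslope g w + (-1 : ℂ) • (g * dslope h w) ∈ J :=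
    hJ.add_mem _ (hJ.mul_mem h hhJ _ hG) _ (hJ.smul_mem _ _ (hJ.mul_mem g hg _ hH))
  convert hJ.mul_mem _ (hJ.smul_mem (h w)⁻¹ _ hdiff) _
    (memA_affine hα (-1) ((starRingEnd ℂ) w)) using 1
  ext z
  simp only [Pi.mul_apply, Pi.add_apply, Pi.smul_apply, smul_eq_mul]
  by_cases hz : z = w
  · subst hz
    simp only [if_true, dslope_same, hgw]
    field_simp
    ring
  · have h1 : z - w ≠ 0 := sub_ne_zero.2 hz
    have h2 : w - z ≠ 0 := sub_ne_zero.2 (Ne.symm hz)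
    rw [if_neg hz, dslope_of_ne g hz, dslope_of_ne h hz, slope_def_field, slope_def_field, hgw]
    rw [← neg_sub z w]
    field_simp
    ring
end
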